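/- arXiv:0810.4130 — 2 statements merged into one kernel-verified Lean document; each statement's English description precedes it below -/
import Mathlib

section
/- Time-convolution integral estimate in dimensions d ≥ 3: for every integer d ≥ 3 there is a constant C > 0 such that for all t ≥ 0, ∫_0^t (1 + t - s)^{1/2 - d/4} (t - s)^{-1/2} (1 + s)^{-d/2} ds ≤ C (1+t)^{-d/4}. -/
open MeasureTheory

/-- An integrable majorant on `(0, ∞)` combining an integrable singularity at the origin with
decay at infinity. -/
noncomputable def convolutionMajorant (u : ℝ) : ℝ :=
  (1 + u) ^ (-(3 : ℝ) / 2) + (Set.Ioo (0 : ℝ) 1).indicator (fun v => v ^ (-(1 : ℝ) / 2)) u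

lemma convolutionMajorant_nonneg {u : ℝ} (hu : 0 ≤ u) : 0 ≤ convolutionMajorant u :=
  add_nonneg (Real.rpow_nonneg (by linarith) _)
    (Set.indicator_nonneg (fun _ hv => Real.rpow_nonneg hv.1.le _) _)

lemma rpow_le_convolutionMajorant (u : ℝ) :
    (1 + u) ^ (-(3 : ℝ) / 2) ≤ convolutionMajorant u :=
  le_add_of_nonneg_right (Set.indicator_nonneg (fun _ hv => Real.rpow_nonneg hv.1.le _) _)

lemma rpow_neg_half_le_convolutionMajorant {u : ℝ} (hu : 0 < u) (hu1 : u < 1) :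
    u ^ (-(1 : ℝ) / 2) ≤ convolutionMajorant u := by
  rw [convolutionMajorant, Set.indicator_of_mem (Set.mem_Ioo.2 ⟨hu, hu1⟩)]
  exact le_add_of_nonneg_left (Real.rpow_nonneg (by linarith) _)

lemma integrableOn_convolutionMajorant :
    IntegrableOn convolutionMajorant (Set.Ioi 0) := by
  refine Integrable.add ?_ ?_
  · have h := integrableOn_add_rpow_Ioi_of_lt (a := -(3 : ℝ) / 2) (c := 0) (m := 1)
      (by norm_num) (by norm_num)
    simpa only [IntegrableOn, add_comm] using h
  · refine Integrable.integrableOn ?_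
    rw [integrable_indicator_iff measurableSet_Ioo]
    exact (intervalIntegral.integrableOn_Ioo_rpow_iff one_pos).2 (by norm_num)

/-- A negative power of a quantity that is at least half of `T` is controlled by that of `T`. -/
lemma rpow_neg_le_of_le_two_mul {x T p : ℝ} (hT : 0 < T) (h : T ≤ 2 * x) (hp : 0 ≤ p) :
    x ^ (-p) ≤ 2 ^ p * T ^ (-p) := by
  have hx : 0 < x := by linarith
  calc x ^ (-p) = 2 ^ p * (2 * x) ^ (-p) := by
        rw [Real.mul_rpow zero_le_two hx.le, ← mul_assoc, ← Real.rpow_add two_pos]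
        simp
    _ ≤ 2 ^ p * T ^ (-p) := by
        gcongr 2 ^ p * ?_
        exact Real.rpow_le_rpow_of_nonpos hT h (by linarith)

lemma sqrt_one_add_mul_rpow_neg_half_le_two {u : ℝ} (hu : 1 ≤ u) :
    (1 + u) ^ ((1 : ℝ) / 2) * u ^ (-(1 : ℝ) / 2) ≤ 2 := by
  have hu0 : 0 < u := by linarith
  have h : (1 + u) ^ ((1 : ℝ) / 2) ≤ 2 * u ^ ((1 : ℝ) / 2) := by
    calc (1 + u) ^ ((1 : ℝ) / 2) ≤ (4 * u) ^ ((1 : ℝ) / 2) :=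
          Real.rpow_le_rpow (by linarith) (by linarith) (by norm_num)
      _ = 2 * u ^ ((1 : ℝ) / 2) := by
          rw [Real.mul_rpow (by norm_num) hu0.le, show (4 : ℝ) = 2 ^ (2 : ℝ) by norm_num,
            ← Real.rpow_mul zero_le_two]
          norm_num
  calc (1 + u) ^ ((1 : ℝ) / 2) * u ^ (-(1 : ℝ) / 2)
      ≤ 2 * u ^ ((1 : ℝ) / 2) * u ^ (-(1 : ℝ) / 2) := by gcongr
    _ = 2 := by rw [mul_assoc, ← Real.rpow_add hu0]; norm_num

/-- Pointwise domination of the convolution integrand, with `u = t - s` and `p = d / 4`. -/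
lemma convolution_integrand_le {u s p : ℝ} (hu : 0 < u) (hs : 0 < s) (hp : 3 / 4 ≤ p) :
    (1 + u) ^ ((1 : ℝ) / 2 - p) * u ^ (-(1 : ℝ) / 2) * (1 + s) ^ (-(2 * p))
      ≤ 2 * 2 ^ p * (1 + (s + u)) ^ (-p) * (convolutionMajorant s + convolutionMajorant u) := by
  have ha : 0 < 1 + u := by linarith
  have hb : 0 < 1 + s := by linarith
  have hT : 0 < 1 + (s + u) := by linarith
  have hms := convolutionMajorant_nonneg hs.le
  have hmu := convolutionMajorant_nonneg hu.le
  have hsplit : (1 + s) ^ (-(2 * p)) = (1 + s) ^ (-p) * (1 + s) ^ (-p) := by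
    rw [← Real.rpow_add hb]; ring_nf
  have hK : 0 ≤ 2 ^ p * (1 + (s + u)) ^ (-p) := by positivity
  rcases lt_or_ge u 1 with h1 | h1
  · have e1 : (1 + u) ^ ((1 : ℝ) / 2 - p) ≤ 1 :=
      Real.rpow_le_one_of_one_le_of_nonpos (by linarith) (by linarith)
    have e2 := rpow_neg_half_le_convolutionMajorant hu h1
    have e3 : (1 + s) ^ (-p) ≤ 1 :=
      Real.rpow_le_one_of_one_le_of_nonpos (by linarith) (by linarith)
    have e4 := rpow_neg_le_of_le_two_mul (p := p) hT
      (show 1 + (s + u) ≤ 2 * (1 + s) by linarith) (by linarith)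
    calc _ ≤ 1 * convolutionMajorant u * (1 * (2 ^ p * (1 + (s + u)) ^ (-p))) := by
          rw [hsplit]; gcongr
      _ ≤ _ := by nlinarith [mul_nonneg hK hms, mul_nonneg hK hmu]
  · have key : (1 + u) ^ (-p) * (1 + s) ^ (-(2 * p)) ≤
        2 ^ p * (1 + (s + u)) ^ (-p) * (convolutionMajorant s + convolutionMajorant u) := by
      rcases le_total s u with hsu | hsu
      · have e1 := rpow_neg_le_of_le_two_mul (p := p) hT
          (show 1 + (s + u) ≤ 2 * (1 + u) by linarith) (by linarith)
        have e2 : (1 + s) ^ (-(2 * p)) ≤ convolutionMajorant s :=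
          (Real.rpow_le_rpow_of_exponent_le (by linarith) (by linarith)).trans
            (rpow_le_convolutionMajorant s)
        gcongr
        linarith
      · have e1 := rpow_neg_le_of_le_two_mul (p := p) hT
          (show 1 + (s + u) ≤ 2 * (1 + s) by linarith) (by linarith)
        have e2 : (1 + s) ^ (-p) ≤ (1 + u) ^ (-p) :=
          Real.rpow_le_rpow_of_nonpos ha (by linarith) (by linarith)
        have e3 : (1 + u) ^ (-p) * (1 + u) ^ (-p) ≤ convolutionMajorant u := by
          rw [← Real.rpow_add ha]
          exact (Real.rpow_le_rpow_of_exponent_le (by linarith) (by linarith)).trans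
            (rpow_le_convolutionMajorant u)
        calc _ = (1 + s) ^ (-p) * ((1 + u) ^ (-p) * (1 + s) ^ (-p)) := by rw [hsplit]; ring
          _ ≤ (2 ^ p * (1 + (s + u)) ^ (-p)) * ((1 + u) ^ (-p) * (1 + u) ^ (-p)) := by gcongr
          _ ≤ _ := by gcongr; linarith
    calc _ = ((1 + u) ^ ((1 : ℝ) / 2) * u ^ (-(1 : ℝ) / 2)) *
          ((1 + u) ^ (-p) * (1 + s) ^ (-(2 * p))) := by
          rw [sub_eq_add_neg, Real.rpow_add ha]; ring
      _ ≤ 2 * (2 ^ p * (1 + (s + u)) ^ (-p) *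
          (convolutionMajorant s + convolutionMajorant u)) :=
          mul_le_mul (sqrt_one_add_mul_rpow_neg_half_le_two h1) key (by positivity) zero_le_two
      _ = _ := by ring

lemma intervalIntegrable_convolutionMajorant {t : ℝ} (ht : 0 ≤ t) :
    IntervalIntegrable convolutionMajorant volume 0 t :=
  (intervalIntegrable_iff_integrableOn_Ioc_of_le ht).2
    (integrableOn_convolutionMajorant.mono_set Set.Ioc_subset_Ioi_self)

lemma intervalIntegrable_convolutionMajorant_add_reflect {t : ℝ} (ht : 0 ≤ t) :
    IntervalIntegrable (fun s => convolutionMajorant s + convolutionMajorant (t - s))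
      volume 0 t := by
  have h := intervalIntegrable_convolutionMajorant ht
  exact h.add (by simpa using (h.comp_sub_left t).symm)

lemma integral_convolutionMajorant_add_reflect_le {t : ℝ} (ht : 0 ≤ t) :
    ∫ s in (0 : ℝ)..t, (convolutionMajorant s + convolutionMajorant (t - s)) ≤
      2 * ∫ u in Set.Ioi (0 : ℝ), convolutionMajorant u := by
  have h := intervalIntegrable_convolutionMajorant ht
  rw [intervalIntegral.integral_add h (by simpa using (h.comp_sub_left t).symm),
    intervalIntegral.integral_comp_sub_left, sub_self, sub_zero, ← two_mul,
    intervalIntegral.integral_of_le ht]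
  gcongr 2 * ?_
  refine setIntegral_mono_set integrableOn_convolutionMajorant ?_
    Set.Ioc_subset_Ioi_self.eventuallyLE
  exact ae_restrict_of_forall_mem measurableSet_Ioi
    fun u hu => convolutionMajorant_nonneg (le_of_lt hu)

/-- Time-convolution integral estimate in dimensions `d ≥ 3`: there is `C > 0` with
`∫_0^t (1+t-s)^{1/2 - d/4} (t-s)^{-1/2} (1+s)^{-d/2} ds ≤ C (1+t)^{-d/4}` for all
`t ≥ 0`. -/
theorem time_convolution_integral_estimate (d : ℕ) (hd : 3 ≤ d) :
    ∃ C : ℝ, 0 < C ∧ ∀ t : ℝ, 0 ≤ t →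
      (∫ s in Set.Ioo (0 : ℝ) t,
          (1 + t - s) ^ ((1 : ℝ) / 2 - (d : ℝ) / 4) * (t - s) ^ (-(1 : ℝ) / 2)
            * (1 + s) ^ (-(d : ℝ) / 2))
        ≤ C * (1 + t) ^ (-(d : ℝ) / 4) := by
  have hp : (3 : ℝ) / 4 ≤ (d : ℝ) / 4 := by
    have : (3 : ℝ) ≤ d := by exact_mod_cast hd
    linarith
  set M := ∫ u in Set.Ioi (0 : ℝ), convolutionMajorant u with hM
  have hM0 : 0 ≤ M :=
    setIntegral_nonneg measurableSet_Ioi fun u hu => convolutionMajorant_nonneg (le_of_lt hu)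
  refine ⟨2 * 2 ^ ((d : ℝ) / 4) * (2 * M) + 1, by positivity, fun t ht => ?_⟩
  have hT : 0 < 1 + t := by linarith
  set K := 2 * 2 ^ ((d : ℝ) / 4) * (1 + t) ^ (-((d : ℝ) / 4)) with hK
  have hK0 : 0 ≤ K := by positivity
  have hint : IntegrableOn (fun s => convolutionMajorant s + convolutionMajorant (t - s))
      (Set.Ioo 0 t) :=
    (intervalIntegrable_iff_integrableOn_Ioo_of_le ht).1
      (intervalIntegrable_convolutionMajorant_add_reflect ht)
  calc _ ≤ ∫ s in Set.Ioo (0 : ℝ) t,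
        K * (convolutionMajorant s + convolutionMajorant (t - s)) := by
        refine integral_mono_of_nonneg ?_ (hint.const_mul K) ?_
        · refine ae_restrict_of_forall_mem measurableSet_Ioo fun s hs => ?_
          have h1 : 0 < t - s := sub_pos.2 hs.2
          have h2 : 0 < 1 + t - s := by linarith
          have h3 : 0 < 1 + s := by linarith [hs.1]
          simp only [Pi.zero_apply]
          positivity
        · refine ae_restrict_of_forall_mem measurableSet_Ioo fun s hs => ?_
          have h := convolution_integrand_le (sub_pos.2 hs.2) hs.1 hp
          rw [add_sub_cancel, ← add_sub_assoc,
            show -(2 * ((d : ℝ) / 4)) = -(d : ℝ) / 2 by ring] at h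
          exact h
    _ = K * ∫ s in (0 : ℝ)..t, (convolutionMajorant s + convolutionMajorant (t - s)) := by
        rw [integral_const_mul, intervalIntegral.integral_of_le ht, integral_Ioc_eq_integral_Ioo]
    _ ≤ K * (2 * M) := by
        gcongr
        exact integral_convolutionMajorant_add_reflect_le ht
    _ ≤ _ := by
        have h : 0 < (1 + t) ^ (-((d : ℝ) / 4)) := by positivity
        rw [hK, neg_div]
        linarith
end

section
/- Abstract nonlinear stability iteration in dimensions d ≥ 3 (skeleton of Theorem 2 of the paper): let d ≥ 3 be an integer and C₀ ≥ 1. Then there exist ε₀ > 0 and C ≥ 1, depending only on d and C₀, with the following property: if 0 < ε ≤ ε₀ and v : [0,∞) → [0,∞) is continuous with v(0) ≤ ε and satisfies, for all t ≥ 0, v(t) ≤ C₀ ε (1+t)^{-d/4} + C₀ ( sup_{0 ≤ s ≤ t} (1+s)^{d/4} v(s) )² ∫_0^t (1 + t - s)^{1/2 - d/4} (t - s)^{-1/2} (1 + s)^{-d/2} ds, then v(t) ≤ C ε (1+t)^{-d/4} for all t ≥ 0. -/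
open MeasureTheory

/-- If `w` stays at most `M` as long as its past does, with strict improvement, then a continuous
`w` starting below `M` never exceeds `M`. -/
theorem le_of_continuousOn_of_bootstrap {w : ℝ → ℝ} {M : ℝ} (hw : ContinuousOn w (Set.Ici 0))
    (h0 : w 0 ≤ M) (hstep : ∀ t, 0 ≤ t → (∀ s ∈ Set.Icc 0 t, w s ≤ M) → w t < M)
    {t : ℝ} (ht : 0 ≤ t) : w t ≤ M := by
  by_contra! hlt
  have hexists : ∀ r, 0 ≤ r → M < w r → ∃ s ∈ Set.Icc 0 r, w s = M := fun r hr hMr =>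
    intermediate_value_Icc hr (hw.mono Set.Icc_subset_Ici_self) ⟨h0, hMr.le⟩
  have hcompact : IsCompact (Set.Icc 0 t ∩ w ⁻¹' {M}) :=
    isCompact_Icc.of_isClosed_subset
      ((hw.mono Set.Icc_subset_Ici_self).preimage_isClosed_of_isClosed isClosed_Icc
        isClosed_singleton) Set.inter_subset_left
  obtain ⟨r, ⟨hr, hwr⟩, hleast⟩ := hcompact.exists_isLeast (hexists t ht hlt)
  refine (hstep r hr.1 fun s hs => ?_).ne hwr
  by_contra! hMs
  obtain ⟨q, hq, hwq⟩ := hexists s hs.1 hMs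
  have hrq : r ≤ q := hleast ⟨⟨hq.1, hq.2.trans (hs.2.trans hr.2)⟩, hwq⟩
  have hsr : s = r := le_antisymm hs.2 (hrq.trans hq.2)
  rw [hsr] at hMs
  exact hMs.ne' hwr

theorem hasDerivAt_neg_two_mul_sqrt_sub {t s : ℝ} (hst : s < t) :
    HasDerivAt (fun x => -2 * √(t - x)) ((t - s) ^ (-(1 : ℝ) / 2)) s := by
  have hpos : 0 < t - s := sub_pos.2 hst
  have h := (((hasDerivAt_id s).const_sub t).sqrt hpos.ne').const_mul (-2)
  refine h.congr_deriv ?_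
  rw [neg_div 2 (1 : ℝ), Real.rpow_neg hpos.le, ← Real.sqrt_eq_rpow]
  have := Real.sqrt_pos.2 hpos
  simp only [id]
  field_simp

theorem hasDerivAt_neg_two_div_mul_sqrt_div {t s : ℝ} (hs : 0 ≤ s) (hst : s < t) :
    HasDerivAt (fun x => -2 / (1 + t) * (√(t - x) / √(1 + x)))
      ((t - s) ^ (-(1 : ℝ) / 2) * (1 + s) ^ (-(3 : ℝ) / 2)) s := by
  have hpos : 0 < t - s := sub_pos.2 hst
  have hs1 : 0 < 1 + s := by linarith
  have ht1 : 0 < 1 + t := by linarith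
  have h1 := ((hasDerivAt_id s).const_sub t).sqrt hpos.ne'
  have h2 := ((hasDerivAt_id s).const_add 1).sqrt hs1.ne'
  have hp := Real.sqrt_pos.2 hpos
  have hq := Real.sqrt_pos.2 hs1
  have h := (h1.div h2 hq.ne').const_mul (-2 / (1 + t))
  refine h.congr_deriv ?_
  have e : (1 + s) ^ (-(3 : ℝ) / 2) = ((1 + s) * √(1 + s))⁻¹ := by
    rw [neg_div, Real.rpow_neg hs1.le, show (3 : ℝ) / 2 = 1 + 1 / 2 by norm_num,
      Real.rpow_add hs1, Real.rpow_one, ← Real.sqrt_eq_rpow]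
  rw [e, neg_div 2 (1 : ℝ), Real.rpow_neg hpos.le, ← Real.sqrt_eq_rpow]
  simp only [id]
  have e1 := Real.sq_sqrt hpos.le
  have e2 := Real.sq_sqrt hs1.le
  field_simp
  rw [e1, e2]
  ring

theorem duhamel_kernel_nonneg {p q r t s : ℝ} (hs : 0 ≤ s) (hst : s ≤ t) :
    0 ≤ (1 + t - s) ^ p * (t - s) ^ q * (1 + s) ^ r := by
  have h1 : 0 ≤ t - s := sub_nonneg.2 hst
  have h2 : 0 ≤ 1 + t - s := by linarith
  positivity

/-- Pointwise splitting of the Duhamel kernel according to `s ≤ t / 2` or `s ≥ t / 2`. -/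
theorem duhamel_kernel_le {a t s : ℝ} (ha : 3 / 4 ≤ a) (hs : 0 ≤ s) (hst : s < t) :
    (1 + t - s) ^ (1 / 2 - a) * (t - s) ^ (-(1 : ℝ) / 2) * (1 + s) ^ (-(2 * a)) ≤
      2 ^ (2 * a) * ((1 + t) ^ (1 / 2 - a) *
          ((t - s) ^ (-(1 : ℝ) / 2) * (1 + s) ^ (-(3 : ℝ) / 2))
        + (1 + t) ^ (-(2 * a)) * (t - s) ^ (-(1 : ℝ) / 2)) := by
  have hs1 : 0 < 1 + s := by linarith
  have ht1 : 0 < 1 + t := by linarith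
  have hts : 0 < t - s := sub_pos.2 hst
  have hts1 : 0 < 1 + t - s := by linarith
  have hk : 0 < (t - s) ^ (-(1 : ℝ) / 2) := Real.rpow_pos_of_pos hts _
  have half : ∀ p : ℝ, ((1 + t) / 2) ^ (-p) = 2 ^ p * (1 + t) ^ (-p) := fun p => by
    rw [Real.div_rpow ht1.le zero_le_two, Real.rpow_neg zero_le_two, div_inv_eq_mul, mul_comm]
  rcases le_total s (t / 2) with h | h
  · have hA : (1 + t - s) ^ (1 / 2 - a) ≤ 2 ^ (2 * a) * (1 + t) ^ (1 / 2 - a) := by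
      calc (1 + t - s) ^ (1 / 2 - a) ≤ ((1 + t) / 2) ^ (1 / 2 - a) :=
            Real.rpow_le_rpow_of_nonpos (by linarith) (by linarith) (by linarith)
        _ = 2 ^ (a - 1 / 2) * (1 + t) ^ (1 / 2 - a) := by rw [← neg_sub a, half]
        _ ≤ _ := by
          gcongr
          · norm_num
          · linarith
    have hB : (1 + s) ^ (-(2 * a)) ≤ (1 + s) ^ (-(3 : ℝ) / 2) :=
      Real.rpow_le_rpow_of_exponent_le (by linarith) (by linarith)
    calc _ ≤ (2 ^ (2 * a) * (1 + t) ^ (1 / 2 - a)) * (t - s) ^ (-(1 : ℝ) / 2)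
          * (1 + s) ^ (-(3 : ℝ) / 2) := by gcongr
      _ = 2 ^ (2 * a) * ((1 + t) ^ (1 / 2 - a) *
          ((t - s) ^ (-(1 : ℝ) / 2) * (1 + s) ^ (-(3 : ℝ) / 2))) := by ring
      _ ≤ _ := by
        gcongr
        exact le_add_of_nonneg_right (by positivity)
  · have hA : (1 + t - s) ^ (1 / 2 - a) ≤ 1 :=
      Real.rpow_le_one_of_one_le_of_nonpos (by linarith) (by linarith)
    have hB : (1 + s) ^ (-(2 * a)) ≤ 2 ^ (2 * a) * (1 + t) ^ (-(2 * a)) := by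
      rw [← half]
      exact Real.rpow_le_rpow_of_nonpos (by linarith) (by linarith) (by linarith)
    calc _ ≤ 1 * (t - s) ^ (-(1 : ℝ) / 2) * (2 ^ (2 * a) * (1 + t) ^ (-(2 * a))) := by gcongr
      _ = 2 ^ (2 * a) * ((1 + t) ^ (-(2 * a)) * (t - s) ^ (-(1 : ℝ) / 2)) := by ring
      _ ≤ _ := by
        gcongr
        exact le_add_of_nonneg_left (by positivity)

theorem setIntegral_duhamel_kernel_le {a t : ℝ} (ha : 3 / 4 ≤ a) (ht : 0 ≤ t) :
    ∫ s in Set.Ioo (0 : ℝ) t,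
        (1 + t - s) ^ (1 / 2 - a) * (t - s) ^ (-(1 : ℝ) / 2) * (1 + s) ^ (-(2 * a)) ≤
      4 * 2 ^ (2 * a) * (1 + t) ^ (-a) := by
  have ht1 : 0 < 1 + t := by linarith
  set G : ℝ → ℝ := fun x => 2 ^ (2 * a) *
    ((1 + t) ^ (1 / 2 - a) * (-2 / (1 + t) * (√(t - x) / √(1 + x)))
      + (1 + t) ^ (-(2 * a)) * (-2 * √(t - x))) with hG
  set g : ℝ → ℝ := fun s => 2 ^ (2 * a) * ((1 + t) ^ (1 / 2 - a) *
          ((t - s) ^ (-(1 : ℝ) / 2) * (1 + s) ^ (-(3 : ℝ) / 2))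
        + (1 + t) ^ (-(2 * a)) * (t - s) ^ (-(1 : ℝ) / 2)) with hg
  have hderiv : ∀ s ∈ Set.Ioo 0 t, HasDerivAt G (g s) s := fun s hs =>
    (((hasDerivAt_neg_two_div_mul_sqrt_div hs.1.le hs.2).const_mul _).add
      ((hasDerivAt_neg_two_mul_sqrt_sub hs.2).const_mul _)).const_mul _
  have hcont : ContinuousOn G (Set.Icc 0 t) := by
    have : ∀ x ∈ Set.Icc 0 t, √(1 + x) ≠ 0 := fun x hx =>
      (Real.sqrt_pos.2 (by linarith [hx.1])).ne'
    fun_prop (disch := assumption)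
  have hnonneg : ∀ s ∈ Set.Ioo 0 t, 0 ≤ g s := fun s hs => by
    have h1 : 0 < t - s := sub_pos.2 hs.2
    have h2 : 0 < 1 + s := by linarith [hs.1]
    positivity
  have hint : IntegrableOn g (Set.Ioc 0 t) :=
    intervalIntegral.integrableOn_deriv_of_nonneg hcont hderiv hnonneg
  have hFTC : ∫ s in Set.Ioo (0 : ℝ) t, g s = G t - G 0 := by
    rw [← integral_Ioc_eq_integral_Ioo, ← intervalIntegral.integral_of_le ht]
    exact intervalIntegral.integral_eq_sub_of_hasDerivAt_of_le ht hcont hderiv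
      ((intervalIntegrable_iff_integrableOn_Ioc_of_le ht).2 hint)
  have hle : ∫ s in Set.Ioo (0 : ℝ) t,
      (1 + t - s) ^ (1 / 2 - a) * (t - s) ^ (-(1 : ℝ) / 2) * (1 + s) ^ (-(2 * a)) ≤
      ∫ s in Set.Ioo (0 : ℝ) t, g s := by
    refine integral_mono_of_nonneg ?_ (hint.mono_set Set.Ioo_subset_Ioc_self) ?_
    · filter_upwards [ae_restrict_mem measurableSet_Ioo] with s hs
      exact duhamel_kernel_nonneg hs.1.le hs.2.le
    · filter_upwards [ae_restrict_mem measurableSet_Ioo] with s hs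
      exact duhamel_kernel_le ha hs.1.le hs.2
  have hsqrt : √t ≤ (1 + t) ^ (1 / 2 : ℝ) := by
    rw [← Real.sqrt_eq_rpow]
    exact Real.sqrt_le_sqrt (by linarith)
  have hnear : (1 + t) ^ (1 / 2 - a) * (2 / (1 + t) * √t) ≤ 2 * (1 + t) ^ (-a) := by
    calc _ ≤ (1 + t) ^ (1 / 2 - a) * (2 / (1 + t) * (1 + t) ^ (1 / 2 : ℝ)) := by gcongr
      _ = 2 * ((1 + t) ^ (1 / 2 - a) * (1 + t) ^ (1 / 2 : ℝ) * (1 + t) ^ (-1 : ℝ)) := by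
        rw [Real.rpow_neg_one]; ring
      _ = 2 * (1 + t) ^ (-a) := by
        rw [← Real.rpow_add ht1, ← Real.rpow_add ht1]; ring_nf
  have hfar : (1 + t) ^ (-(2 * a)) * (2 * √t) ≤ 2 * (1 + t) ^ (-a) := by
    calc _ ≤ (1 + t) ^ (-(2 * a)) * (2 * (1 + t) ^ (1 / 2 : ℝ)) := by gcongr
      _ = 2 * (1 + t) ^ (-(2 * a) + 1 / 2) := by rw [Real.rpow_add ht1]; ring
      _ ≤ 2 * (1 + t) ^ (-a) := by
        gcongr
        · linarith
        · linarith
  calc _ ≤ G t - G 0 := hle.trans_eq hFTC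
    _ = 2 ^ (2 * a) * ((1 + t) ^ (1 / 2 - a) * (2 / (1 + t) * √t)
        + (1 + t) ^ (-(2 * a)) * (2 * √t)) := by
      simp only [hG, sub_self, sub_zero, add_zero, Real.sqrt_zero, Real.sqrt_one]
      ring
    _ ≤ 2 ^ (2 * a) * (2 * (1 + t) ^ (-a) + 2 * (1 + t) ^ (-a)) := by gcongr
    _ = _ := by ring

/-- Abstract nonlinear stability iteration in dimensions `d ≥ 3` (skeleton of
Theorem 2): there are `ε₀ > 0` and `C ≥ 1`, depending only on `d` and `C₀`, such that
any continuous `v : [0,∞) → [0,∞)` with `v(0) ≤ ε ≤ ε₀` satisfying the Duhamel-type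
inequality
`v(t) ≤ C₀ ε (1+t)^{-d/4}
  + C₀ (sup_{0 ≤ s ≤ t} (1+s)^{d/4} v(s))² ∫_0^t (1+t-s)^{1/2-d/4}(t-s)^{-1/2}(1+s)^{-d/2} ds`
obeys `v(t) ≤ C ε (1+t)^{-d/4}` for all `t ≥ 0`. -/
theorem abstract_nonlinear_stability_iteration (d : ℕ) (hd : 3 ≤ d)
    (C₀ : ℝ) (hC₀ : 1 ≤ C₀) :
    ∃ ε₀ C : ℝ, 0 < ε₀ ∧ 1 ≤ C ∧
      ∀ ε : ℝ, 0 < ε → ε ≤ ε₀ →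
      ∀ v : ℝ → ℝ, ContinuousOn v (Set.Ici 0) → (∀ t, 0 ≤ t → 0 ≤ v t) → v 0 ≤ ε →
      (∀ t, 0 ≤ t →
        v t ≤ C₀ * ε * (1 + t) ^ (-(d : ℝ) / 4)
          + C₀ * (sSup ((fun s => (1 + s) ^ ((d : ℝ) / 4) * v s) '' Set.Icc 0 t)) ^ 2
            * ∫ s in Set.Ioo (0 : ℝ) t,
                (1 + t - s) ^ ((1 : ℝ) / 2 - (d : ℝ) / 4) * (t - s) ^ (-(1 : ℝ) / 2)
                  * (1 + s) ^ (-(d : ℝ) / 2)) →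
      ∀ t, 0 ≤ t → v t ≤ C * ε * (1 + t) ^ (-(d : ℝ) / 4) := by
  obtain ⟨a, had⟩ : ∃ a : ℝ, a = (d : ℝ) / 4 := ⟨_, rfl⟩
  have ha : 3 / 4 ≤ a := by
    have : (3 : ℝ) ≤ d := by exact_mod_cast hd
    linarith
  have e1 : -(d : ℝ) / 4 = -a := by rw [had]; ring
  have e2 : -(d : ℝ) / 2 = -(2 * a) := by rw [had]; ring
  rw [e1, e2, ← had]
  set K : ℝ := 4 * 2 ^ (2 * a) with hK
  have hKpos : 0 < K := by positivity
  have hCpos : 0 < C₀ := by linarith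
  refine ⟨1 / (8 * C₀ ^ 2 * K), 2 * C₀, by positivity, by linarith, ?_⟩
  intro ε hε hεle v hv hvnonneg hv0 hduhamel t ht
  have hsmall : 8 * C₀ ^ 2 * K * ε ≤ 1 := by
    rwa [le_div_iff₀ (by positivity), mul_comm] at hεle
  set w : ℝ → ℝ := fun s => (1 + s) ^ a * v s with hw
  have hcancel : ∀ s : ℝ, 0 ≤ s → (1 + s) ^ (-a) * (1 + s) ^ a = 1 := fun s hs => by
    rw [← Real.rpow_add (by linarith), neg_add_cancel, Real.rpow_zero]
  have hwnonneg : ∀ s, 0 ≤ s → 0 ≤ w s := fun s hs =>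
    mul_nonneg (Real.rpow_nonneg (by linarith) _) (hvnonneg s hs)
  have hwcont : ContinuousOn w (Set.Ici 0) := by
    refine ContinuousOn.mul (ContinuousOn.rpow_const (by fun_prop) fun s hs => Or.inl ?_) hv
    have : (0 : ℝ) ≤ s := hs
    linarith
  have hbound : w t ≤ 2 * C₀ * ε := by
    refine le_of_continuousOn_of_bootstrap hwcont ?_ (fun r hr hpast => ?_) ht
    · simp only [hw, add_zero, Real.one_rpow, one_mul]
      nlinarith
    · have hη : sSup (w '' Set.Icc 0 r) ≤ 2 * C₀ * ε :=
        csSup_le ((Set.nonempty_Icc.2 hr).image w) (Set.forall_mem_image.2 hpast)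
      have hη0 : 0 ≤ sSup (w '' Set.Icc 0 r) :=
        Real.sSup_nonneg (Set.forall_mem_image.2 fun s hs => hwnonneg s hs.1)
      have hr1 : 0 < 1 + r := by linarith
      have hvr : v r ≤ C₀ * ε * (1 + r) ^ (-a)
          + C₀ * (2 * C₀ * ε) ^ 2 * (K * (1 + r) ^ (-a)) := by
        refine (hduhamel r hr).trans ?_
        have hle := setIntegral_duhamel_kernel_le ha hr
        have hnonneg := setIntegral_nonneg (μ := volume) measurableSet_Ioo
          fun s (hs : s ∈ Set.Ioo 0 r) =>
            duhamel_kernel_nonneg (p := 1 / 2 - a) (q := -1 / 2) (r := -(2 * a)) hs.1.le hs.2.le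
        gcongr
      calc w r ≤ (1 + r) ^ a * (C₀ * ε * (1 + r) ^ (-a)
          + C₀ * (2 * C₀ * ε) ^ 2 * (K * (1 + r) ^ (-a))) := by
            simp only [hw]
            gcongr
        _ = ((1 + r) ^ (-a) * (1 + r) ^ a) * (C₀ * ε + C₀ * (2 * C₀ * ε) ^ 2 * K) := by ring
        _ = C₀ * ε + C₀ * ε / 2 * (8 * C₀ ^ 2 * K * ε) := by rw [hcancel r hr]; ring
        _ ≤ C₀ * ε + C₀ * ε / 2 * 1 := by gcongr
        _ < 2 * C₀ * ε := by linarith [mul_pos hCpos hε]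
  calc v t = ((1 + t) ^ (-a) * (1 + t) ^ a) * v t := by rw [hcancel t ht, one_mul]
    _ = w t * (1 + t) ^ (-a) := by simp only [hw]; ring
    _ ≤ 2 * C₀ * ε * (1 + t) ^ (-a) :=
      mul_le_mul_of_nonneg_right hbound (Real.rpow_nonneg (by linarith) _)
end
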